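/- arXiv:1207.5394 — 2 statements merged into one kernel-verified Lean document; each statement's English description precedes it below -/
import Mathlib

section
/- A pair of ℂ-linear maps (δ₊, δ₋) on a unital Jordan *-algebra A over ℂ is a derivation pair if, and only if, all of the following hold for all a, b ∈ A: (i) δ₊(a ∘ b) = (δ₊ a) ∘ b + a ∘ (δ₊ b) + ⦃a, δ₋ 1, b⦄ and δ₋(a ∘ b) = (δ₋ a) ∘ b + a ∘ (δ₋ b) + ⦃a, δ₊ 1, b⦄; (ii) δ₊(b*) = 2 (δ₊ 1) ∘ b* + (δ₋ b)* and δ₋(b*) = 2 (δ₋ 1) ∘ b* + (δ₊ b)*. -/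
/-- The Jordan triple product `⦃x,y,z⦄ := (x∘y*)∘z + (z∘y*)∘x − (x∘z)∘y*` on a
Jordan *-algebra (whose ring multiplication is the Jordan product `∘`). -/
def jordanTriple {A : Type*} [NonAssocRing A] [Star A] (x y z : A) : A :=
  x * star y * z + z * star y * x - x * z * star y

/-- The linearized Jordan identity. -/
theorem jordan_linearized {A : Type*} [NonUnitalNonAssocCommRing A] [IsCommJordan A]
    [IsAddTorsionFree A] (a b c d : A) :
    a * (d * (b * c)) + b * (d * (c * a)) + c * (d * (a * b)) =
      b * c * (a * d) + c * a * (b * d) + a * b * (c * d) := by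
  have h := congrArg (fun f : AddMonoid.End A => f d)
    (two_nsmul_lie_lmul_lmul_add_add_eq_zero a b c)
  have h' : 2 • (a * (b * c * d) - b * c * (a * d) + (b * (c * a * d) - c * a * (b * d)) +
      (c * (a * b * d) - a * b * (c * d))) = 0 := h
  have h'' := (smul_eq_zero_iff_right two_ne_zero).1 h'
  rw [mul_comm d, mul_comm d, mul_comm d, ← sub_eq_zero, ← h'']
  abel

/-- Multiplication by `p` is a derivation of the (linear) Jordan triple product, up to the
sign in the middle variable. -/
theorem mul_linear_jordanTriple {A : Type*} [NonUnitalNonAssocCommRing A] [IsCommJordan A]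
    [IsAddTorsionFree A] (p x w z : A) :
    p * (x * w * z + z * w * x - x * z * w) =
      (p * x * w * z + z * w * (p * x) - p * x * z * w) -
        (x * (p * w) * z + z * (p * w) * x - x * z * (p * w)) +
        (x * w * (p * z) + p * z * w * x - x * (p * z) * w) := by
  have hz := jordan_linearized p x w z
  have hx := jordan_linearized p z w x
  have hw := jordan_linearized p x z w
  simp only [mul_add, mul_sub, mul_comm] at hx hw hz ⊢
  grind

/-- The Jordan derivation identity with defect `ε 1`, together with its compatibility with the
involution, gives the derivation identity for the Jordan triple product. -/
theorem map_jordanTriple {A : Type*} [NonAssocRing A] [Module ℂ A] [StarRing A]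
    (hcomm : ∀ x y : A, x * y = y * x)
    (hjordan : ∀ x y : A, (x * y) * (x * x) = x * (y * (x * x)))
    (δ ε : A →ₗ[ℂ] A)
    (hmul : ∀ a b : A, δ (a * b) = δ a * b + a * δ b + jordanTriple a (ε 1) b)
    (hstar : ∀ b : A, δ (star b) = (2 : ℂ) • (δ 1 * star b) + star (ε b)) (x y z : A) :
    δ (jordanTriple x y z) =
      jordanTriple (δ x) y z + jordanTriple x (ε y) z + jordanTriple x y (δ z) := by
  let _ : NonUnitalNonAssocCommRing A := { ‹NonAssocRing A› with mul_comm := hcomm }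
  have : IsCommJordan A := ⟨hjordan⟩
  have : IsAddTorsionFree A := .of_isTorsionFree ℂ A
  have hone : star (ε 1) = -δ 1 := by
    have h := hmul 1 1
    simp only [jordanTriple, mul_one, one_mul] at h
    grind
  have hmul' (a b : A) : δ (a * b) =
      δ a * b + a * δ b - (a * δ 1 * b + b * δ 1 * a - a * b * δ 1) := by
    rw [hmul, jordanTriple, hone]
    simp only [mul_neg, neg_mul]
    abel
  have hε : star (ε y) = δ (star y) - (δ 1 * star y + δ 1 * star y) := by
    rw [hstar, two_smul]
    abel
  simp only [jordanTriple, hε]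
  have key := mul_linear_jordanTriple (δ 1) x (star y) z
  generalize star y = w at *
  simp only [map_add, map_sub, hmul']
  generalize δ 1 = p at *
  simp only [mul_add, mul_sub, mul_comm] at key ⊢
  grind

/-- A pair of `ℂ`-linear maps `(δ₊, δ₋)` on a unital Jordan *-algebra `A` over `ℂ` is a
derivation pair if and only if
(i) `δ±(a∘b) = δ±a∘b + a∘δ±b + ⦃a, δ∓1, b⦄` for all `a, b`, and
(ii) `δ±(b*) = 2(δ±1)∘b* + (δ∓b)*` for all `b`. -/
theorem derivation_pair_iff
    {A : Type*} [NonAssocRing A] [Module ℂ A] [SMulCommClass ℂ A A] [IsScalarTower ℂ A A]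
    [StarRing A] [StarModule ℂ A]
    (hcomm : ∀ x y : A, x * y = y * x)
    (hjordan : ∀ x y : A, (x * y) * (x * x) = x * (y * (x * x)))
    (δp δm : A →ₗ[ℂ] A) :
    ((∀ x y z : A, δp (jordanTriple x y z) =
        jordanTriple (δp x) y z + jordanTriple x (δm y) z + jordanTriple x y (δp z)) ∧
     (∀ x y z : A, δm (jordanTriple x y z) =
        jordanTriple (δm x) y z + jordanTriple x (δp y) z + jordanTriple x y (δm z))) ↔
    ((∀ a b : A, δp (a * b) = δp a * b + a * δp b + jordanTriple a (δm 1) b) ∧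
     (∀ a b : A, δm (a * b) = δm a * b + a * δm b + jordanTriple a (δp 1) b) ∧
     (∀ b : A, δp (star b) = (2 : ℂ) • (δp 1 * star b) + star (δm b)) ∧
     (∀ b : A, δm (star b) = (2 : ℂ) • (δm 1 * star b) + star (δp b))) := by
  constructor
  · have forward (δ ε : A →ₗ[ℂ] A) (h : ∀ x y z : A, δ (jordanTriple x y z) =
        jordanTriple (δ x) y z + jordanTriple x (ε y) z + jordanTriple x y (δ z)) :
        (∀ a b : A, δ (a * b) = δ a * b + a * δ b + jordanTriple a (ε 1) b) ∧
        (∀ b : A, δ (star b) = (2 : ℂ) • (δ 1 * star b) + star (ε b)) := by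
      have triple_one (a b : A) : jordanTriple a 1 b = a * b := by
        simp [jordanTriple, hcomm b a]
      refine ⟨fun a b => ?_, fun b => ?_⟩
      · have := h a 1 b
        simp only [triple_one] at this
        rw [this]
        abel
      · have := h 1 b 1
        simp only [jordanTriple, one_mul, mul_one, add_sub_cancel_right,
          hcomm (star b) (δ 1)] at this
        rw [this, two_smul]
        abel
    rintro ⟨hp, hm⟩
    exact ⟨(forward δp δm hp).1, (forward δm δp hm).1, (forward δp δm hp).2,
      (forward δm δp hm).2⟩
  · rintro ⟨hp, hm, hps, hms⟩
    exact ⟨map_jordanTriple hcomm hjordan δp δm hp hps,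
      map_jordanTriple hcomm hjordan δm δp hm hms⟩
end

section
/- Let n ∈ ℕ and let A = Matrix (Fin n) (Fin n) ℂ with the conjugate-transpose star. Every local triple derivation δ : A → A (no continuity assumed) is a triple derivation: δ⦃x,y,z⦄ = ⦃δx, y, z⦄ + ⦃x, δy, z⦄ + ⦃x, y, δz⦄ for all x, y, z ∈ A. (This is the finite-rank case, where every element is a finite linear combination of mutually orthogonal tripotents.) -/
/-- The triple product `⦃x,y,z⦄ := (x·y*·z + z·y*·x)/2` on an associative star algebra. -/
noncomputable def tp {A : Type*} [Ring A] [Algebra ℂ A] [Star A] (x y z : A) : A :=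
  (2 : ℂ)⁻¹ • (x * star y * z + z * star y * x)

/-- A triple derivation: a `ℂ`-linear map `δ` with
`δ⦃x,y,z⦄ = ⦃δx,y,z⦄ + ⦃x,δy,z⦄ + ⦃x,y,δz⦄` for all `x,y,z`. -/
def IsTripleDerivation {A : Type*} [Ring A] [Algebra ℂ A] [Star A] (δ : A →ₗ[ℂ] A) : Prop :=
  ∀ x y z : A, δ (tp x y z) = tp (δ x) y z + tp x (δ y) z + tp x y (δ z)

section TripleDefect

variable {A : Type*} [Ring A] [Algebra ℂ A]

/-- The failure of the Leibniz rule for `δ` with respect to the triple product. -/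
noncomputable def tripleDefect [Star A] (δ : A →ₗ[ℂ] A) (x y z : A) : A :=
  δ (tp x y z) - (tp (δ x) y z + tp x (δ y) z + tp x y (δ z))

theorem tripleDefect_comm [Star A] (δ : A →ₗ[ℂ] A) (x y z : A) :
    tripleDefect δ x y z = tripleDefect δ z y x := by
  simp only [tripleDefect, tp, map_add, map_smul, ← smul_add, ← smul_sub]
  congr 1
  abel

theorem tp_self_of_tripotent [Star A] {e : A} (he : e * star e * e = e) : tp e e e = e := by
  rw [tp, he, ← two_smul ℂ e, smul_smul, inv_mul_cancel₀ two_ne_zero, one_smul]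

theorem tripleDefect_self_of_tripotent [Star A] {δ : A →ₗ[ℂ] A}
    (hloc : ∀ x : A, ∃ T : A →ₗ[ℂ] A, IsTripleDerivation T ∧ T x = δ x)
    {e : A} (he : e * star e * e = e) : tripleDefect δ e e e = 0 := by
  obtain ⟨T, hT, hTe⟩ := hloc e
  have h := hT e e e
  rw [tp_self_of_tripotent he, hTe] at h
  rw [tripleDefect, tp_self_of_tripotent he, ← h, sub_self]

variable [StarRing A]

theorem tripleDefect_add_left (δ : A →ₗ[ℂ] A) (x x' y z : A) :
    tripleDefect δ (x + x') y z = tripleDefect δ x y z + tripleDefect δ x' y z := by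
  simp only [tripleDefect, tp, map_add, map_smul, add_mul, mul_add, smul_add]
  abel

theorem tripleDefect_add_middle (δ : A →ₗ[ℂ] A) (x y y' z : A) :
    tripleDefect δ x (y + y') z = tripleDefect δ x y z + tripleDefect δ x y' z := by
  simp only [tripleDefect, tp, map_add, map_smul, star_add, add_mul, mul_add, smul_add]
  abel

theorem tripleDefect_add_right (δ : A →ₗ[ℂ] A) (x y z z' : A) :
    tripleDefect δ x y (z + z') = tripleDefect δ x y z + tripleDefect δ x y z' := by
  rw [tripleDefect_comm, tripleDefect_add_left, tripleDefect_comm δ z, tripleDefect_comm δ z']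

theorem tripleDefect_sum_left {ι : Type*} (δ : A →ₗ[ℂ] A) (s : Finset ι) (f : ι → A) (y z : A) :
    tripleDefect δ (∑ i ∈ s, f i) y z = ∑ i ∈ s, tripleDefect δ (f i) y z :=
  map_sum (AddMonoidHom.mk' (fun x ↦ tripleDefect δ x y z)
    fun x x' ↦ tripleDefect_add_left δ x x' y z) f s

theorem tripleDefect_sum_middle {ι : Type*} (δ : A →ₗ[ℂ] A) (s : Finset ι) (f : ι → A)
    (x z : A) : tripleDefect δ x (∑ i ∈ s, f i) z = ∑ i ∈ s, tripleDefect δ x (f i) z :=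
  map_sum (AddMonoidHom.mk' (fun y ↦ tripleDefect δ x y z)
    fun y y' ↦ tripleDefect_add_middle δ x y y' z) f s

theorem tripleDefect_sum_right {ι : Type*} (δ : A →ₗ[ℂ] A) (s : Finset ι) (f : ι → A) (x y : A) :
    tripleDefect δ x y (∑ i ∈ s, f i) = ∑ i ∈ s, tripleDefect δ x y (f i) :=
  map_sum (AddMonoidHom.mk' (fun z ↦ tripleDefect δ x y z)
    fun z z' ↦ tripleDefect_add_right δ x y z z') f s

/-- Polarization in the outer variables. -/
theorem tripleDefect_eq_zero_of_outer {δ : A →ₗ[ℂ] A} {x y z : A}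
    (hx : tripleDefect δ x y x = 0) (hz : tripleDefect δ z y z = 0)
    (hxz : tripleDefect δ (x + z) y (x + z) = 0) : tripleDefect δ x y z = 0 := by
  rw [tripleDefect_add_left, tripleDefect_add_right, tripleDefect_add_right, hx, hz,
    tripleDefect_comm δ z, zero_add, add_zero, ← two_smul ℂ] at hxz
  exact (smul_eq_zero.mp hxz).resolve_left two_ne_zero

theorem tripleDefect_smul_left (δ : A →ₗ[ℂ] A) (c : ℂ) (x y z : A) :
    tripleDefect δ (c • x) y z = c • tripleDefect δ x y z := by
  simp only [tripleDefect, tp, map_add, map_smul, smul_mul_assoc, mul_smul_comm, smul_add,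
    smul_sub, smul_comm c]

theorem tripleDefect_smul_right (δ : A →ₗ[ℂ] A) (c : ℂ) (x y z : A) :
    tripleDefect δ x y (c • z) = c • tripleDefect δ x y z := by
  rw [tripleDefect_comm, tripleDefect_smul_left, tripleDefect_comm]

variable [StarModule ℂ A]

theorem tripleDefect_smul_middle (δ : A →ₗ[ℂ] A) (c : ℂ) (x y z : A) :
    tripleDefect δ x (c • y) z = star c • tripleDefect δ x y z := by
  simp only [tripleDefect, tp, map_add, map_smul, star_smul, smul_mul_assoc, mul_smul_comm,
    smul_add, smul_sub, smul_comm (star c)]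

/-- Polarization of the cubic map `x ↦ tripleDefect δ x x x` over the circle. -/
theorem tripleDefect_polarization {δ : A →ₗ[ℂ] A} {x y : A}
    (hx : tripleDefect δ x x x = 0) (hy : tripleDefect δ y y y = 0)
    (h : ∀ c : ℂ, c * star c = 1 → tripleDefect δ (x + c • y) (x + c • y) (x + c • y) = 0) :
    tripleDefect δ x y y = 0 ∧ tripleDefect δ y x y = 0 := by
  have key (c : ℂ) (hc : c * star c = 1) :
      (2 * c) • tripleDefect δ x x y + star c • tripleDefect δ x y x
        + (2 : ℂ) • tripleDefect δ x y y + (c * c) • tripleDefect δ y x y = 0 := by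
    have h' := h c hc
    simp only [tripleDefect_add_left, tripleDefect_add_middle, tripleDefect_add_right,
      tripleDefect_smul_left, tripleDefect_smul_middle, tripleDefect_smul_right, hx, hy,
      smul_zero, tripleDefect_comm δ y x x, tripleDefect_comm δ y y x] at h'
    simp only [smul_add, smul_smul, mul_comm (star c) c, hc] at h'
    rw [← h']
    module
  have h1 := key 1 (by simp)
  have h2 := key (-1) (by simp)
  have h3 := key Complex.I (by simp)
  have h4 := key (-Complex.I) (by simp)
  simp only [star_neg, star_one, Complex.star_def, Complex.conj_I, neg_mul_neg,
    Complex.I_mul_I] at h1 h2 h3 h4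
  have hp : (4 : ℂ) • tripleDefect δ x y y + (2 : ℂ) • tripleDefect δ y x y = 0 := by
    linear_combination (norm := module) h1 + h2
  have hm : (4 : ℂ) • tripleDefect δ x y y - (2 : ℂ) • tripleDefect δ y x y = 0 := by
    linear_combination (norm := module) h3 + h4
  constructor
  · linear_combination (norm := module) (8 : ℂ)⁻¹ • hp + (8 : ℂ)⁻¹ • hm
  · linear_combination (norm := module) (4 : ℂ)⁻¹ • hp - (4 : ℂ)⁻¹ • hm

theorem isTripleDerivation_of_tripleDefect_self {δ : A →ₗ[ℂ] A}
    (h : ∀ x, tripleDefect δ x x x = 0) : IsTripleDerivation δ := by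
  have hout (x y : A) : tripleDefect δ x y x = 0 :=
    (tripleDefect_polarization (h y) (h x) fun c _ ↦ h _).2
  exact fun x y z ↦ sub_eq_zero.mp
    (tripleDefect_eq_zero_of_outer (hout x y) (hout z y) (hout (x + z) y))

omit [Algebra ℂ A] [StarModule ℂ A] in
theorem tripotent_add {e f : A} (he : e * star e * e = e) (hf : f * star f * f = f)
    (h₁ : e * star f = 0) (h₂ : star e * f = 0) :
    (e + f) * star (e + f) * (e + f) = e + f := by
  have h₃ : f * star e = 0 := by simpa using congrArg star h₁
  have h₄ : star f * e = 0 := by simpa using congrArg star h₂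
  simp only [star_add, add_mul, mul_add, h₁, h₃, he, hf, add_zero, zero_add]
  simp only [mul_assoc, h₂, h₄, mul_zero, add_zero, zero_add]

theorem tripotent_smul {e : A} (he : e * star e * e = e) {c : ℂ} (hc : c * star c = 1) :
    (c • e) * star (c • e) * (c • e) = c • e := by
  simp only [star_smul, smul_mul_assoc, mul_smul_comm, smul_smul, he]
  rw [mul_comm (star c), hc, mul_one]

theorem tripleDefect_of_orthogonal_pair {δ : A →ₗ[ℂ] A}
    (hloc : ∀ x : A, ∃ T : A →ₗ[ℂ] A, IsTripleDerivation T ∧ T x = δ x)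
    {e f : A} (he : e * star e * e = e) (hf : f * star f * f = f)
    (h₁ : e * star f = 0) (h₂ : star e * f = 0) :
    tripleDefect δ e f f = 0 ∧ tripleDefect δ f e f = 0 :=
  tripleDefect_polarization (tripleDefect_self_of_tripotent hloc he)
    (tripleDefect_self_of_tripotent hloc hf) fun c hc ↦
      tripleDefect_self_of_tripotent hloc
        (tripotent_add he (tripotent_smul hf hc) (by simp [h₁]) (by simp [h₂]))

theorem tripleDefect_of_orthogonal_family {ι : Type*} {δ : A →ₗ[ℂ] A}
    (hloc : ∀ x : A, ∃ T : A →ₗ[ℂ] A, IsTripleDerivation T ∧ T x = δ x)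
    {e : ι → A} (he : ∀ i, e i * star (e i) * e i = e i)
    (h₁ : Pairwise fun i j ↦ e i * star (e j) = 0)
    (h₂ : Pairwise fun i j ↦ star (e i) * e j = 0) (i j k : ι) :
    tripleDefect δ (e i) (e j) (e k) = 0 := by
  have pair {a b : ι} (hab : a ≠ b) :=
    tripleDefect_of_orthogonal_pair hloc (he a) (he b) (h₁ hab) (h₂ hab)
  by_cases hij : i = j
  · subst hij
    by_cases hik : i = k
    · subst hik
      exact tripleDefect_self_of_tripotent hloc (he i)
    · rw [tripleDefect_comm]
      exact (pair (Ne.symm hik)).1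
  by_cases hjk : j = k
  · subst hjk
    exact (pair hij).1
  by_cases hik : i = k
  · subst hik
    exact (pair (Ne.symm hij)).2
  refine tripleDefect_eq_zero_of_outer (pair (Ne.symm hij)).2 (pair hjk).2 ?_
  exact (tripleDefect_of_orthogonal_pair hloc (he j)
    (tripotent_add (he i) (he k) (h₁ hik) (h₂ hik))
    (by rw [star_add, mul_add, h₁ (Ne.symm hij), h₁ hjk, add_zero])
    (by rw [mul_add, h₂ (Ne.symm hij), h₂ hjk, add_zero])).2

end TripleDefect

open Matrix in
open scoped ComplexOrder in
/-- Singular value decomposition, as a combination of pairwise orthogonal partial isometries. -/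
theorem Matrix.exists_orthogonal_tripotents {ι : Type*} [Fintype ι] [DecidableEq ι]
    (x : Matrix ι ι ℂ) :
    ∃ (c : ι → ℂ) (e : ι → Matrix ι ι ℂ), x = ∑ i, c i • e i ∧
      (∀ i, e i * star (e i) * e i = e i) ∧
      (Pairwise fun i j ↦ e i * star (e j) = 0) ∧
      (Pairwise fun i j ↦ star (e i) * e j = 0) := by
  have hpos : (star x * x).PosSemidef := posSemidef_conjTranspose_mul_self x
  let U : Matrix ι ι ℂ := hpos.isHermitian.eigenvectorUnitary
  let l : ι → ℝ := hpos.isHermitian.eigenvalues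
  have hl (i : ι) : 0 ≤ l i := hpos.eigenvalues_nonneg i
  have hU : star U * U = 1 := Unitary.coe_star_mul_self _
  have hU' : U * star U = 1 := Unitary.coe_mul_star_self _
  have hspec : star x * x = U * diagonal (fun i ↦ (l i : ℂ)) * star U :=
    hpos.isHermitian.spectral_theorem
  let P (i : ι) : Matrix ι ι ℂ := U * single i i 1 * star U
  have hPstar (i : ι) : star (P i) = P i := by
    simp [P, star_eq_conjTranspose, mul_assoc, conjTranspose_single]
  have hPP (i j : ι) : P i * P j = U * (single i i (1 : ℂ) * single j j 1) * star U := by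
    calc P i * P j = U * single i i 1 * (star U * U) * single j j 1 * star U := by
          simp only [P, mul_assoc]
      _ = _ := by rw [hU]; simp only [mul_one, mul_assoc]
  have hPself (i : ι) : P i * P i = P i := by simp [hPP, P]
  have hPne {i j : ι} (hij : i ≠ j) : P i * P j = 0 := by simp [hPP, hij]
  have hsum : ∑ i, P i = 1 := by
    simp only [P, ← Finset.sum_mul, ← Finset.mul_sum]
    rw [sum_single_one, mul_one, hU']
  have hxP (i : ι) : star x * x * P i = (l i : ℂ) • P i := by
    have hd : diagonal (fun i ↦ (l i : ℂ)) * single i i 1 = (l i : ℂ) • single i i (1 : ℂ) := by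
      ext a b
      rw [diagonal_mul, smul_apply, smul_eq_mul]
      by_cases ha : i = a
      · rw [ha]
      · simp [ha]
    calc star x * x * P i
        = U * diagonal (fun i ↦ (l i : ℂ)) * (star U * U) * single i i 1 * star U := by
          rw [hspec]; simp only [P, mul_assoc]
      _ = U * (diagonal (fun i ↦ (l i : ℂ)) * single i i 1) * star U := by
          rw [hU]; simp only [mul_one, mul_assoc]
      _ = _ := by
          rw [hd, mul_smul_comm, smul_mul_assoc]
  have hzero {i : ι} (hi : l i = 0) : x * P i = 0 := by
    have h : (x * P i)ᴴ * (x * P i) = 0 := by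
      rw [← star_eq_conjTranspose, star_mul, mul_assoc, ← mul_assoc (star x), hxP, hi]
      simp
    exact conjTranspose_mul_self_eq_zero.mp h
  let s (i : ι) : ℂ := (√(l i) : ℝ)
  have hsstar (i : ι) : star (s i) = s i := Complex.conj_ofReal _
  have hss (i : ι) : s i * s i = l i := by
    simp only [s, ← Complex.ofReal_mul, Real.mul_self_sqrt (hl i)]
  have hs0 {i : ι} (hi : l i ≠ 0) : s i ≠ 0 := by
    intro h
    have := hss i
    rw [h, mul_zero] at this
    exact hi (by exact_mod_cast this.symm)
  refine ⟨s, fun i ↦ (s i)⁻¹ • (x * P i), ?_, fun i ↦ ?_, fun i j hij ↦ ?_, fun i j hij ↦ ?_⟩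
  · calc x = ∑ i, x * P i := by rw [← Finset.mul_sum, hsum, mul_one]
      _ = _ := Finset.sum_congr rfl fun i _ ↦ by
        by_cases hi : l i = 0
        · simp [hzero hi]
        · rw [smul_smul, mul_inv_cancel₀ (hs0 hi), one_smul]
  · by_cases hi : l i = 0
    · simp [hzero hi]
    · have h : x * P i * star (x * P i) * (x * P i) = (l i : ℂ) • (x * P i) := by
        calc x * P i * star (x * P i) * (x * P i) = x * (P i * P i) * (star x * x * P i) := by
              rw [star_mul, hPstar]; simp only [mul_assoc]
          _ = _ := by rw [hPself, hxP, mul_smul_comm, mul_assoc, hPself]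
      simp only [star_smul, smul_mul_assoc, mul_smul_comm, smul_smul, h, star_inv₀, hsstar, ← hss]
      congr 1
      field_simp [hs0 hi]
  · have h : x * P i * star (x * P j) = 0 := by
      rw [star_mul, hPstar, mul_assoc, ← mul_assoc (P i), hPne hij, zero_mul, mul_zero]
    simp only [star_smul, smul_mul_assoc, mul_smul_comm, h, smul_zero]
  · have h : star (x * P i) * (x * P j) = 0 := by
      rw [star_mul, hPstar, mul_assoc, ← mul_assoc (star x), hxP, mul_smul_comm, hPne hij,
        smul_zero]
    simp only [star_smul, smul_mul_assoc, mul_smul_comm, h, smul_zero]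

/-- Every local triple derivation on the n×n complex matrices (with conjugate-transpose
star), with no continuity assumption, is a triple derivation. -/
theorem matrix_local_triple_derivation_is_triple_derivation
    (n : ℕ) (δ : Matrix (Fin n) (Fin n) ℂ →ₗ[ℂ] Matrix (Fin n) (Fin n) ℂ)
    (hloc : ∀ x : Matrix (Fin n) (Fin n) ℂ,
      ∃ T : Matrix (Fin n) (Fin n) ℂ →ₗ[ℂ] Matrix (Fin n) (Fin n) ℂ,
        IsTripleDerivation T ∧ T x = δ x) :
    IsTripleDerivation δ := by
  refine isTripleDerivation_of_tripleDefect_self fun x ↦ ?_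
  obtain ⟨c, e, rfl, he, h₁, h₂⟩ := x.exists_orthogonal_tripotents
  simp only [tripleDefect_sum_left, tripleDefect_sum_middle, tripleDefect_sum_right,
    tripleDefect_smul_left, tripleDefect_smul_middle, tripleDefect_smul_right,
    tripleDefect_of_orthogonal_family hloc he h₁ h₂, smul_zero, Finset.sum_const_zero]
end
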